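/- Let A be a real symmetric n×n matrix, B a real symmetric m×m matrix, C a real n×m matrix, G ∈ ℝ^{n×r}, H ∈ ℝ^{m×r}, let ξ = (ξ_G, ξ_H) and η = (η_G, η_H) with ξ_G, η_G ∈ ℝ^{n×r} and ξ_H, η_H ∈ ℝ^{m×r}, and let ω₁, ω₂, ω₃, ω₄ be real numbers. Define g_{(G,H)}(ξ, η) = ω₁⟨η_G, Aξ_G HᵀBH⟩ + ω₂⟨η_G, 2AG·Sym(HᵀBξ_H) + Cξ_H⟩ + ω₃⟨η_H, Bξ_H GᵀAG⟩ + ω₄⟨η_H, 2BH·Sym(GᵀAξ_G) + Cᵀξ_G⟩, where ⟨P, Q⟩ = Trace(PᵀQ) and Sym(D) = (D + Dᵀ)/2. Then for every invertible real r×r matrix M, g_{(GM⁻¹, HMᵀ)}((ξ_G M⁻¹, ξ_H Mᵀ), (η_G M⁻¹, η_H Mᵀ)) = g_{(G,H)}((ξ_G, ξ_H), (η_G, η_H)). -/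

import Mathlib

open Matrix

/-- The symmetric part of a square matrix, `Sym(D) = (D + Dᵀ)/2`. -/
noncomputable def symPart {r : ℕ} (D : Matrix (Fin r) (Fin r) ℝ) : Matrix (Fin r) (Fin r) ℝ :=
  (1 / 2 : ℝ) • (D + Dᵀ)

/-- The metric candidate of the fixed-rank quadratic problem. -/
noncomputable def gFR {n m r : ℕ}
    (A : Matrix (Fin n) (Fin n) ℝ) (B : Matrix (Fin m) (Fin m) ℝ) (C : Matrix (Fin n) (Fin m) ℝ)
    (ω₁ ω₂ ω₃ ω₄ : ℝ)
    (G : Matrix (Fin n) (Fin r) ℝ) (H : Matrix (Fin m) (Fin r) ℝ)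
    (ξG ηG : Matrix (Fin n) (Fin r) ℝ) (ξH ηH : Matrix (Fin m) (Fin r) ℝ) : ℝ :=
  ω₁ * (ηGᵀ * (A * ξG * (Hᵀ * B * H))).trace +
  ω₂ * (ηGᵀ * (2 • (A * G * symPart (Hᵀ * B * ξH)) + C * ξH)).trace +
  ω₃ * (ηHᵀ * (B * ξH * (Gᵀ * A * G))).trace +
  ω₄ * (ηHᵀ * (2 • (B * H * symPart (Gᵀ * A * ξG)) + Cᵀ * ξG)).trace

/-- The symmetric part commutes with congruence transformations. -/
lemma symPart_transpose_mul_mul {r : ℕ} (Q D : Matrix (Fin r) (Fin r) ℝ) :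
    symPart (Qᵀ * D * Q) = Qᵀ * symPart D * Q := by
  simp [symPart, transpose_mul, Matrix.mul_add, Matrix.add_mul, Matrix.mul_assoc]

/-- If `P * Qᵀ = 1`, then `X ↦ Pᵀ * X * Q` preserves the trace. -/
lemma trace_transpose_mul_mul_of_mul_transpose_eq_one {r : ℕ}
    {P Q : Matrix (Fin r) (Fin r) ℝ} (h : P * Qᵀ = 1) (X : Matrix (Fin r) (Fin r) ℝ) :
    (Pᵀ * X * Q).trace = X.trace := by
  have h' : Q * Pᵀ = 1 := by simpa using congrArg transpose h
  rw [Matrix.mul_assoc, trace_mul_comm, Matrix.mul_assoc, h', Matrix.mul_one]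

lemma trace_diagonal_block_invariant {n m r : ℕ}
    (A : Matrix (Fin n) (Fin n) ℝ) (B : Matrix (Fin m) (Fin m) ℝ)
    (H : Matrix (Fin m) (Fin r) ℝ) (ξ η : Matrix (Fin n) (Fin r) ℝ)
    {P Q : Matrix (Fin r) (Fin r) ℝ} (h : P * Qᵀ = 1) :
    ((η * P)ᵀ * (A * (ξ * P) * ((H * Q)ᵀ * B * (H * Q)))).trace =
      (ηᵀ * (A * ξ * (Hᵀ * B * H))).trace := by
  rw [← trace_transpose_mul_mul_of_mul_transpose_eq_one h (ηᵀ * (A * ξ * (Hᵀ * B * H)))]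
  congr 1
  calc _ = Pᵀ * (ηᵀ * (A * ξ * ((P * Qᵀ) * (Hᵀ * B * H)))) * Q := by
        simp only [transpose_mul, Matrix.mul_assoc]
    _ = _ := by rw [h, Matrix.one_mul]

lemma trace_mixed_block_invariant {n m r : ℕ}
    (A : Matrix (Fin n) (Fin n) ℝ) (B : Matrix (Fin m) (Fin m) ℝ) (C : Matrix (Fin n) (Fin m) ℝ)
    (G : Matrix (Fin n) (Fin r) ℝ) (H : Matrix (Fin m) (Fin r) ℝ)
    (η : Matrix (Fin n) (Fin r) ℝ) (ξ : Matrix (Fin m) (Fin r) ℝ)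
    {P Q : Matrix (Fin r) (Fin r) ℝ} (h : P * Qᵀ = 1) :
    ((η * P)ᵀ * (2 • (A * (G * P) * symPart ((H * Q)ᵀ * B * (ξ * Q))) + C * (ξ * Q))).trace =
      (ηᵀ * (2 • (A * G * symPart (Hᵀ * B * ξ)) + C * ξ)).trace := by
  rw [← trace_transpose_mul_mul_of_mul_transpose_eq_one h
    (ηᵀ * (2 • (A * G * symPart (Hᵀ * B * ξ)) + C * ξ))]
  have hS : symPart ((H * Q)ᵀ * B * (ξ * Q)) = Qᵀ * symPart (Hᵀ * B * ξ) * Q := by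
    rw [← symPart_transpose_mul_mul]
    simp only [transpose_mul, Matrix.mul_assoc]
  rw [hS]
  congr 1
  calc _ = Pᵀ * (ηᵀ * (2 • (A * G * ((P * Qᵀ) * symPart (Hᵀ * B * ξ))) + C * ξ)) * Q := by
        simp only [transpose_mul, Matrix.mul_assoc, Matrix.mul_add, Matrix.add_mul,
          Matrix.mul_smul, Matrix.smul_mul]
    _ = _ := by rw [h, Matrix.one_mul]

/-- Invariance of the metric candidate family (42) of the fixed-rank quadratic problem under
the `GL(r)` symmetry action `(G, H) ↦ (GM⁻¹, HMᵀ)`, `(ξ_G, ξ_H) ↦ (ξ_G M⁻¹, ξ_H Mᵀ)`,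
`(η_G, η_H) ↦ (η_G M⁻¹, η_H Mᵀ)`. -/
theorem metric_invariance_fixed_rank {n m r : ℕ}
    (A : Matrix (Fin n) (Fin n) ℝ) (hA : A.IsSymm)
    (B : Matrix (Fin m) (Fin m) ℝ) (hB : B.IsSymm)
    (C : Matrix (Fin n) (Fin m) ℝ)
    (G : Matrix (Fin n) (Fin r) ℝ) (H : Matrix (Fin m) (Fin r) ℝ)
    (ξG ηG : Matrix (Fin n) (Fin r) ℝ) (ξH ηH : Matrix (Fin m) (Fin r) ℝ)
    (ω₁ ω₂ ω₃ ω₄ : ℝ)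
    (M : Matrix (Fin r) (Fin r) ℝ) (hM : IsUnit M.det) :
    gFR A B C ω₁ ω₂ ω₃ ω₄ (G * M⁻¹) (H * Mᵀ) (ξG * M⁻¹) (ηG * M⁻¹) (ξH * Mᵀ) (ηH * Mᵀ) =
      gFR A B C ω₁ ω₂ ω₃ ω₄ G H ξG ηG ξH ηH := by
  have hPQ : M⁻¹ * Mᵀᵀ = 1 := by rw [transpose_transpose, nonsing_inv_mul M hM]
  have hQP : Mᵀ * M⁻¹ᵀ = 1 := by rw [← transpose_mul, nonsing_inv_mul M hM, transpose_one]
  unfold gFR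
  rw [trace_diagonal_block_invariant A B H ξG ηG hPQ,
    trace_mixed_block_invariant A B C G H ηG ξH hPQ,
    trace_diagonal_block_invariant B A G ξH ηH hQP,
    trace_mixed_block_invariant B A Cᵀ H G ηH ξG hQP]
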